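/- There exists a finite set S of primes with the following property. Let A₁, A₂, A₃ be nonzero integers and let c be a nonzero rational number with c³ = A₃/A₂. Let p ∉ S be a prime with p ∣ A₁, v_p(A₁) odd, and p ∤ A₂A₃. Then for every u ∈ ℤ_p^× (a p-adic unit), there exist w, x₁, x₂, x₃ ∈ ℚ_p with x₁ ≠ 0, w² = A₁x₁⁶ + A₂x₂⁶ + A₃x₃⁶, and x₂² + c·x₃² = u·x₁². -/

import Mathlib

/-- On the surface `w² = A₁x₁⁶ + A₂x₂⁶ + A₃x₃⁶` (with `c³ = A₃/A₂`), the quantity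
`(x₂² + c·x₃²)/x₁²` can be made equal to any prescribed `p`-adic unit. -/
def attainsAllUnits (p : ℕ) (hp : p.Prime) (A₁ A₂ A₃ : ℤ) (c : ℚ) : Prop :=
  haveI : Fact p.Prime := ⟨hp⟩
  ∀ u : ℤ_[p], IsUnit u → ∃ w x₁ x₂ x₃ : ℚ_[p], x₁ ≠ 0 ∧
    w ^ 2 = (A₁ : ℚ_[p]) * x₁ ^ 6 + (A₂ : ℚ_[p]) * x₂ ^ 6 + (A₃ : ℚ_[p]) * x₃ ^ 6 ∧
    x₂ ^ 2 + (c : ℚ_[p]) * x₃ ^ 2 = (u : ℚ_[p]) * x₁ ^ 2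

section QuadraticCharSums

variable {F : Type*} [Field F] [Fintype F] [DecidableEq F]

theorem sum_quadraticChar_linear (hF : ringChar F ≠ 2) {a : F} (ha : a ≠ 0) (b : F) :
    ∑ x : F, quadraticChar F (a * x + b) = 0 := by
  rw [← quadraticChar_sum_zero hF]
  exact Equiv.sum_comp ((Equiv.mulLeft₀ a ha).trans (Equiv.addRight b)) (quadraticChar F)

theorem sum_quadraticChar_mul_add (hF : ringChar F ≠ 2) {d : F} (hd : d ≠ 0) :
    ∑ x : F, quadraticChar F (x * (x + d)) = -1 := by
  have h : ∀ x : F, quadraticChar F (x * (x + d)) =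
      quadraticChar F (d * x⁻¹ + 1) - if x = 0 then 1 else 0 := by
    intro x
    by_cases hx : x = 0
    · simp [hx]
    · have : x * (x + d) = x ^ 2 * (d * x⁻¹ + 1) := by field_simp; ring
      rw [this, map_mul, quadraticChar_sq_one' hx, one_mul, if_neg hx, sub_zero]
  simp_rw [h]
  rw [Finset.sum_sub_distrib,
    show ∑ x : F, quadraticChar F (d * x⁻¹ + 1) = ∑ y : F, quadraticChar F (d * y + 1) from
      Equiv.sum_comp (Equiv.inv F) (fun y => quadraticChar F (d * y + 1)),
    sum_quadraticChar_linear hF hd]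
  simp

theorem sum_comp_eq_sum_mul_card {α β : Type*} [Fintype β] [DecidableEq β] (s : Finset α)
    (φ : α → β) (f : β → ℤ) :
    ∑ x ∈ s, f (φ x) = ∑ v : β, f v * ({x ∈ s | φ x = v}.card : ℤ) := by
  rw [← Finset.sum_fiberwise s φ]
  refine Finset.sum_congr rfl fun v _ => ?_
  have : ∀ x ∈ s.filter (φ · = v), f (φ x) = f v := fun x hx => by rw [(Finset.mem_filter.1 hx).2]
  rw [Finset.sum_congr rfl this]
  simp [mul_comm]

theorem card_filter_sq_eq (hF : ringChar F ≠ 2) (a : F) :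
    (({x : F | x ^ 2 = a} : Finset F).card : ℤ) = quadraticChar F a + 1 := by
  rw [← quadraticChar_card_sqrts hF a]
  congr 2
  ext x
  simp

theorem sum_quadraticChar_sq_add (hF : ringChar F ≠ 2) {d : F} (hd : d ≠ 0) :
    ∑ x : F, quadraticChar F (x ^ 2 + d) = -1 := by
  rw [sum_comp_eq_sum_mul_card Finset.univ (fun x : F => x ^ 2)
    (fun v => quadraticChar F (v + d))]
  simp_rw [card_filter_sq_eq hF, mul_add, mul_one, ← map_mul]
  rw [Finset.sum_add_distrib]
  have := sum_quadraticChar_linear hF one_ne_zero d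
  simp only [one_mul] at this
  rw [this, ← sum_quadraticChar_mul_add hF hd, add_zero]
  simp_rw [mul_comm]

/-- The fibres of `m ↦ m + m⁻¹` are described by the quadratic character. -/
theorem sum_comp_add_inv (hF : ringChar F ≠ 2) (f : F → ℤ) :
    ∑ m : F with m ≠ 0, f (m + m⁻¹) = ∑ z : F, f z * (quadraticChar F (z ^ 2 - 4) + 1) := by
  have h2 : (2 : F) ≠ 0 := Ring.two_ne_zero hF
  rw [sum_comp_eq_sum_mul_card _ (fun m : F => m + m⁻¹) f]
  refine Finset.sum_congr rfl fun z _ => ?_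
  rw [← card_filter_sq_eq hF]
  congr 2
  refine Finset.card_bij (fun m _ => 2 * m - z) ?_ ?_ ?_
  · intro m hm
    simp only [Finset.mem_filter, Finset.mem_univ, true_and] at hm ⊢
    obtain ⟨hm, rfl⟩ := hm
    field_simp
    ring
  · intro m _ n _ h
    simpa [h2] using h
  · intro y hy
    simp only [Finset.mem_filter, Finset.mem_univ, true_and] at hy
    have h4 : (y + z) / 2 * (z - (y + z) / 2) = 1 := by
      have : (4 : F) ≠ 0 := by
        have := mul_ne_zero h2 h2
        norm_num at this
        exact this
      field_simp
      linear_combination -hy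
    have h0 : (y + z) / 2 ≠ 0 := left_ne_zero_of_mul_eq_one h4
    refine ⟨(y + z) / 2, ?_, by field_simp; ring⟩
    simp only [Finset.mem_filter, Finset.mem_univ, true_and]
    refine ⟨h0, ?_⟩
    rw [← eq_inv_of_mul_eq_one_right h4]
    ring

theorem card_filter_cube_eq_le (a : F) : ({y : F | y ^ 3 = a} : Finset F).card ≤ 3 := by
  refine le_trans (Finset.card_le_card fun y hy => ?_)
    ((Multiset.toFinset_card_le _).trans (Polynomial.card_nthRoots 3 a))
  simpa [Polynomial.mem_nthRoots] using hy

theorem abs_quadraticChar_le_one (x : F) : |quadraticChar F x| ≤ 1 := by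
  rcases quadraticChar_isQuadratic F x with h | h | h <;> simp [h]

theorem sum_quadraticChar_mul_sq_sub_add_one (hF : ringChar F ≠ 2) :
    ∑ m : F, quadraticChar F (m * (m ^ 2 - m + 1)) =
      ∑ z : F, quadraticChar F (z * (z - 1) * (z + 3)) := by
  have h1 : ∑ m : F, quadraticChar F (m * (m ^ 2 - m + 1)) =
      ∑ m : F with m ≠ 0, quadraticChar F (m + m⁻¹ - 1) := by
    rw [Finset.sum_filter]
    refine Finset.sum_congr rfl fun m _ => ?_
    split_ifs with hm
    · have : m * (m ^ 2 - m + 1) = m ^ 2 * (m + m⁻¹ - 1) := by field_simp; ring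
      rw [this, map_mul, quadraticChar_sq_one' hm, one_mul]
    · simp only [ne_eq, not_not] at hm
      simp [hm]
  rw [h1, sum_comp_add_inv hF (fun z => quadraticChar F (z - 1))]
  simp_rw [mul_add, mul_one, ← map_mul]
  have := sum_quadraticChar_linear hF one_ne_zero (-1)
  simp only [one_mul, ← sub_eq_add_neg] at this
  rw [Finset.sum_add_distrib, this, add_zero, ← Equiv.sum_comp (Equiv.addRight (1 : F))]
  refine Finset.sum_congr rfl fun z _ => ?_
  congr 1
  simp only [Equiv.coe_addRight]
  ring

theorem abs_sum_quadraticChar_linear_mul_linear (hF : ringChar F ≠ 2) {a b c d : F} (ha : a ≠ 0)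
    (hc : c ≠ 0) (h : a * d - b * c ≠ 0) :
    |∑ x : F, quadraticChar F ((a * x + b) * (c * x + d))| ≤ 1 := by
  have h1 : ∑ x : F, quadraticChar F ((a * x + b) * (c * x + d)) =
      quadraticChar F (a * c) * ∑ x : F, quadraticChar F (x * (x + (a * d - b * c) / (a * c))) := by
    rw [← Equiv.sum_comp (Equiv.addRight (b / a))
      (fun x => quadraticChar F (x * (x + (a * d - b * c) / (a * c)))), Finset.mul_sum]
    refine Finset.sum_congr rfl fun z _ => ?_
    rw [← map_mul]
    congr 1
    simp only [Equiv.coe_addRight]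
    field_simp
    ring
  rw [h1, sum_quadraticChar_mul_add hF (div_ne_zero h (mul_ne_zero ha hc)), abs_mul]
  simpa using abs_quadraticChar_le_one (a * c)

/-- A weak form of the Hasse bound for the curve `y² = z * (z - 1) * (z + 3)`, obtained by comparing
the summand with its pullback under `z ↦ -3 * z`. -/
theorem abs_sum_quadraticChar_cubic_le (hF : ringChar F ≠ 2) (h3 : (3 : F) ≠ 0) :
    2 * |∑ z : F, quadraticChar F (z * (z - 1) * (z + 3))| ≤ Fintype.card F + 3 := by
  have h2 : (2 : F) ≠ 0 := Ring.two_ne_zero hF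
  set g : F → ℤ := fun z => quadraticChar F (z * (z - 1) * (z + 3)) with hg
  have hg1 : ∀ z, |g z| ≤ 1 := fun z => abs_quadraticChar_le_one _
  have hT : ∑ z, g (-3 * z) = ∑ z, g z :=
    Equiv.sum_comp (Equiv.mulLeft₀ (-3 : F) (neg_ne_zero.2 h3)) g
  have hprod : ∀ z, |g z * g (-3 * z) - quadraticChar F ((-1 * z + -3) * (3 * z + 1))| ≤
      (if z = 0 then 1 else 0) + (if z = 1 then 1 else 0) := by
    intro z
    by_cases h0 : z = 0
    · subst h0
      simpa [hg] using abs_quadraticChar_le_one (-3 : F)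
    by_cases h1 : z = 1
    · subst h1
      simpa [hg] using abs_quadraticChar_le_one ((-1 + -3 : F) * (3 + 1))
    have : z * (z - 1) * (z + 3) * (-3 * z * (-3 * z - 1) * (-3 * z + 3)) =
        (3 * z * (z - 1)) ^ 2 * ((-1 * z + -3) * (3 * z + 1)) := by ring
    simp only [hg]
    rw [← map_mul, this, map_mul,
      quadraticChar_sq_one' (mul_ne_zero (mul_ne_zero h3 h0) (sub_ne_zero.2 h1))]
    simp [h0, h1]
  have hlin : |∑ z : F, quadraticChar F ((-1 * z + -3) * (3 * z + 1))| ≤ 1 := by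
    refine abs_sum_quadraticChar_linear_mul_linear hF (neg_ne_zero.2 one_ne_zero) h3 ?_
    have : (-1 * 1 - -3 * 3 : F) = 2 ^ 3 := by norm_num
    rw [this]
    exact pow_ne_zero _ h2
  have hcorr : |∑ z, g z * g (-3 * z)| ≤ 3 := by
    have hd : |∑ z, (g z * g (-3 * z) - quadraticChar F ((-1 * z + -3) * (3 * z + 1)))| ≤ 2 := by
      refine (Finset.abs_sum_le_sum_abs _ _).trans ((Finset.sum_le_sum fun z _ => hprod z).trans ?_)
      simp [Finset.sum_add_distrib]
    rw [Finset.sum_sub_distrib] at hd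
    rw [abs_le] at *
    constructor <;> linarith [hd.1, hd.2, hlin.1, hlin.2]
  have key : ∀ e : ℤ, |e| = 1 → 0 ≤ ∑ z, (1 - e * g z) * (1 - e * g (-3 * z)) := by
    intro e he
    have hle : ∀ z, 0 ≤ 1 - e * g z := fun z => by
      have := le_abs_self (e * g z)
      rw [abs_mul, he, one_mul] at this
      linarith [hg1 z]
    exact Finset.sum_nonneg fun z _ => mul_nonneg (hle _) (hle _)
  have expand : ∀ e : ℤ, e * e = 1 → ∑ z, (1 - e * g z) * (1 - e * g (-3 * z)) =
      Fintype.card F - 2 * e * ∑ z, g z + ∑ z, g z * g (-3 * z) := by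
    intro e he
    have : ∀ z, (1 - e * g z) * (1 - e * g (-3 * z)) =
        1 - e * g z - e * g (-3 * z) + g z * g (-3 * z) := fun z => by
      linear_combination (g z * g (-3 * z)) * he
    simp_rw [this]
    rw [Finset.sum_add_distrib, Finset.sum_sub_distrib, Finset.sum_sub_distrib, ← Finset.mul_sum,
      ← Finset.mul_sum, hT]
    simp
    ring
  have k1 := key 1 (by simp)
  have k2 := key (-1) (by simp)
  rw [expand _ (by norm_num)] at k1 k2
  rw [abs_le] at hcorr
  rcases abs_cases (∑ z, g z) with ⟨h, _⟩ | ⟨h, _⟩ <;> rw [h] <;> linarith [hcorr.1, hcorr.2]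

/-- A weak form of the Hasse bound for the curve `y² = x³ + 1`, obtained from the second moment
over its cubic twists. -/
theorem sq_sum_quadraticChar_cube_add_one_le (hF : ringChar F ≠ 2) :
    ((Fintype.card F : ℤ) - 1) * (∑ x : F, quadraticChar F (x ^ 3 + 1)) ^ 2 ≤
      6 * (Fintype.card F : ℤ) ^ 2 := by
  set S : F → ℤ := fun a => ∑ x : F, quadraticChar F (x ^ 3 + a) with hS
  have hmoment : ∑ a, S a ^ 2 ≤ 2 * (Fintype.card F : ℤ) ^ 2 := by
    have hpair : ∀ x y : F, ∑ a : F, quadraticChar F ((x ^ 3 + a) * (y ^ 3 + a)) ≤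
        (if y ^ 3 = x ^ 3 then (Fintype.card F : ℤ) else 0) - 1 := by
      intro x y
      rw [← Equiv.sum_comp (Equiv.subRight (x ^ 3))]
      simp only [Equiv.subRight_apply]
      split_ifs with hxy
      · rw [hxy]
        have : ∀ a : F, quadraticChar F ((x ^ 3 + (a - x ^ 3)) * (x ^ 3 + (a - x ^ 3))) =
            1 - if a = 0 then 1 else 0 := by
          intro a
          rw [add_sub_cancel, ← sq]
          split_ifs with ha
          · simp [ha]
          · simpa using quadraticChar_sq_one' ha
        simp_rw [this]
        simp
      · rw [zero_sub, ← sum_quadraticChar_mul_add hF (sub_ne_zero.2 hxy)]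
        refine le_of_eq (Finset.sum_congr rfl fun a _ => ?_)
        congr 1
        ring
    calc ∑ a, S a ^ 2
      _ = ∑ x : F, ∑ y : F, ∑ a : F, quadraticChar F ((x ^ 3 + a) * (y ^ 3 + a)) := by
          simp_rw [hS, sq, Finset.sum_mul_sum, ← map_mul]
          rw [Finset.sum_comm]
          exact Finset.sum_congr rfl fun x _ => Finset.sum_comm
      _ ≤ ∑ x : F, ∑ y : F, ((if y ^ 3 = x ^ 3 then (Fintype.card F : ℤ) else 0) - 1) :=
          Finset.sum_le_sum fun x _ => Finset.sum_le_sum fun y _ => hpair x y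
      _ ≤ ∑ x : F, (2 * Fintype.card F : ℤ) := by
          refine Finset.sum_le_sum fun x _ => ?_
          rw [Finset.sum_sub_distrib, ← Finset.sum_filter]
          have : (({y : F | y ^ 3 = x ^ 3} : Finset F).card : ℤ) ≤ 3 :=
            mod_cast card_filter_cube_eq_le _
          simp
          nlinarith
      _ = 2 * (Fintype.card F : ℤ) ^ 2 := by simp; ring
  have htwist : ∀ b : F, b ≠ 0 → S (b ^ 3) ^ 2 = S 1 ^ 2 := by
    intro b hb
    have : S (b ^ 3) = quadraticChar F (b ^ 3) * S 1 := by
      simp only [hS]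
      rw [← Equiv.sum_comp (Equiv.mulLeft₀ b hb), Finset.mul_sum]
      refine Finset.sum_congr rfl fun x _ => ?_
      rw [← map_mul]
      congr 1
      simp only [Equiv.mulLeft₀_apply]
      ring
    rw [this, mul_pow, quadraticChar_sq_one (pow_ne_zero _ hb), one_mul]
  calc ((Fintype.card F : ℤ) - 1) * S 1 ^ 2 ≤ ∑ b : F, S (b ^ 3) ^ 2 := by
        rw [← Finset.add_sum_erase _ _ (Finset.mem_univ (0 : F)),
          Finset.sum_congr rfl fun b hb => htwist b (Finset.ne_of_mem_erase hb)]
        simp [Finset.card_erase_of_mem, Nat.cast_sub Fintype.card_pos]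
        positivity
    _ = ∑ v : F, S v ^ 2 * (({b : F | b ^ 3 = v} : Finset F).card : ℤ) :=
        sum_comp_eq_sum_mul_card Finset.univ (fun b : F => b ^ 3) (fun v => S v ^ 2)
    _ ≤ ∑ v : F, S v ^ 2 * 3 :=
        Finset.sum_le_sum fun v _ =>
          mul_le_mul_of_nonneg_left (mod_cast card_filter_cube_eq_le v) (sq_nonneg _)
    _ ≤ 6 * (Fintype.card F : ℤ) ^ 2 := by
        rw [← Finset.sum_mul]
        linarith

/-- Over a large finite field, the quadratic characters of `m + 1`, `m` and `m² - m + 1` can be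
prescribed simultaneously. -/
theorem exists_quadraticChar_eq (hF : ringChar F ≠ 2) (h3 : (3 : F) ≠ 0)
    (hcard : 1000 ≤ Fintype.card F) {a b e : F} (ha : a ≠ 0) (hb : b ≠ 0) (he : e ≠ 0) :
    ∃ m : F, quadraticChar F (m + 1) = quadraticChar F a ∧
      quadraticChar F m = quadraticChar F b ∧
      quadraticChar F (m ^ 2 - m + 1) = quadraticChar F e := by
  by_contra! hcon
  have hsign : ∀ x y : F, x ≠ 0 → y ≠ 0 → quadraticChar F y ≠ quadraticChar F x →
      1 + quadraticChar F x * quadraticChar F y = 0 := by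
    intro x y hx hy hxy
    rcases quadraticChar_dichotomy hx with h | h <;>
      rcases quadraticChar_dichotomy hy with h' | h' <;> simp_all
  have hfac : ∀ x y : F, 0 ≤ 1 + quadraticChar F x * quadraticChar F y ∧
      1 + quadraticChar F x * quadraticChar F y ≤ 2 := by
    intro x y
    have := abs_quadraticChar_le_one (x * y)
    rw [map_mul, abs_le] at this
    constructor <;> linarith [this.1, this.2]
  have hP : ∀ m : F, (1 + quadraticChar F a * quadraticChar F (m + 1)) *
      (1 + quadraticChar F b * quadraticChar F m) *
      (1 + quadraticChar F e * quadraticChar F (m ^ 2 - m + 1)) ≤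
      (if m = 0 then 8 else 0) + (if m ^ 3 = -1 then 8 else 0) := by
    intro m
    have h8 : (1 + quadraticChar F a * quadraticChar F (m + 1)) *
        (1 + quadraticChar F b * quadraticChar F m) *
        (1 + quadraticChar F e * quadraticChar F (m ^ 2 - m + 1)) ≤ 8 := by
      have h1 := hfac a (m + 1)
      have h2 := hfac b m
      have h3 := hfac e (m ^ 2 - m + 1)
      calc _ ≤ (2 : ℤ) * 2 * 2 := mul_le_mul (mul_le_mul h1.2 h2.2 h2.1 (by norm_num)) h3.2 h3.1
            (by norm_num)
        _ = 8 := by norm_num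
    by_cases h0 : m = 0
    · rw [if_pos h0]
      split_ifs <;> linarith
    by_cases h1 : m ^ 3 = -1
    · rw [if_pos h1]
      split_ifs; linarith
    rw [if_neg h0, if_neg h1]
    have hm : (m + 1) * (m ^ 2 - m + 1) ≠ 0 := fun h => h1 (by linear_combination h)
    by_cases ha' : quadraticChar F (m + 1) = quadraticChar F a
    · by_cases hb' : quadraticChar F m = quadraticChar F b
      · rw [hsign e _ he (right_ne_zero_of_mul hm) (hcon m ha' hb')]
        simp
      · rw [hsign b _ hb h0 hb']
        simp
    · rw [hsign a _ ha (left_ne_zero_of_mul hm) ha']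
      simp
  have hsum := Finset.sum_le_sum fun m (_ : m ∈ Finset.univ) => hP m
  have hbad : ∑ m : F, ((if m = 0 then 8 else 0) + (if m ^ 3 = -1 then 8 else 0) : ℤ) ≤ 32 := by
    have : (({y : F | y ^ 3 = -1} : Finset F).card : ℤ) ≤ 3 := mod_cast card_filter_cube_eq_le _
    rw [Finset.sum_add_distrib, ← Finset.sum_filter (fun m : F => m ^ 3 = -1)]
    simp
    linarith
  have expand : ∀ α β ε : ℤ, ∑ m : F, (1 + α * quadraticChar F (m + 1)) *
      (1 + β * quadraticChar F m) * (1 + ε * quadraticChar F (m ^ 2 - m + 1)) =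
      Fintype.card F + α * ∑ m : F, quadraticChar F (m + 1) + β * ∑ m : F, quadraticChar F m +
      ε * ∑ m : F, quadraticChar F (m ^ 2 - m + 1) +
      (α * β) * ∑ m : F, quadraticChar F (m * (m + 1)) +
      (α * ε) * ∑ m : F, quadraticChar F (m ^ 3 + 1) +
      (β * ε) * ∑ m : F, quadraticChar F (m * (m ^ 2 - m + 1)) +
      (α * β * ε) * ∑ m : F, quadraticChar F (m * (m ^ 3 + 1)) := by
    intro α β ε
    have h1 : (Fintype.card F : ℤ) = ∑ m : F, 1 := by simp
    have hfactor : ∀ m : F, m ^ 3 + 1 = (m + 1) * (m ^ 2 - m + 1) := fun m => by ring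
    rw [h1]
    simp_rw [hfactor, Finset.mul_sum, ← Finset.sum_add_distrib, map_mul]
    exact Finset.sum_congr rfl fun m _ => by ring
  have h2 : (2 : F) ≠ 0 := Ring.two_ne_zero hF
  have h4 : (4 : F) ≠ 0 := by
    have := mul_ne_zero h2 h2
    norm_num at this
    exact this
  have hlin := sum_quadraticChar_linear hF one_ne_zero (1 : F)
  simp only [one_mul] at hlin
  have hquad : ∑ m : F, quadraticChar F (m ^ 2 - m + 1) = -1 := by
    rw [← sum_quadraticChar_sq_add hF (div_ne_zero h3 h4),
      ← Equiv.sum_comp (Equiv.addRight (1 / 2 : F))]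
    refine Finset.sum_congr rfl fun m _ => ?_
    congr 1
    simp only [Equiv.coe_addRight]
    field_simp
    ring
  have hquart : ∑ m : F, quadraticChar F (m * (m ^ 3 + 1)) =
      ∑ m : F, quadraticChar F (m ^ 3 + 1) - 1 := by
    rw [← Equiv.sum_comp (Equiv.inv F) (fun m => quadraticChar F (m ^ 3 + 1))]
    have : (1 : ℤ) = ∑ m : F, if m = 0 then 1 else 0 := by simp
    rw [this, ← Finset.sum_sub_distrib]
    refine Finset.sum_congr rfl fun m _ => ?_
    by_cases hm : m = 0
    · simp [hm]
    · have : m * (m ^ 3 + 1) = (m ^ 2) ^ 2 * (m⁻¹ ^ 3 + 1) := by field_simp; ring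
      rw [this, map_mul, quadraticChar_sq_one' (pow_ne_zero _ hm)]
      simp [hm]
  rw [expand, hlin, quadraticChar_sum_zero hF, hquad, sum_quadraticChar_mul_add hF one_ne_zero,
    hquart] at hsum
  have hJ := sq_sum_quadraticChar_cube_add_one_le hF
  have hT := abs_sum_quadraticChar_cubic_le hF h3
  rw [← sum_quadraticChar_mul_sq_sub_add_one hF] at hT
  set J := ∑ m : F, quadraticChar F (m ^ 3 + 1)
  set T := ∑ m : F, quadraticChar F (m * (m ^ 2 - m + 1))
  have hbd : ∀ (x : F) (n : ℤ), x ≠ 0 → -|n| ≤ quadraticChar F x * n := by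
    intro x n hx
    have : |quadraticChar F x * n| = |n| := by
      rcases quadraticChar_dichotomy hx with h | h <;> simp [h]
    rw [← this]
    exact neg_abs_le _
  have b1 := hbd e (-1) he
  have b2 := hbd (a * b) (-1) (mul_ne_zero ha hb)
  have b3 := hbd (a * e) J (mul_ne_zero ha he)
  have b4 := hbd (b * e) T (mul_ne_zero hb he)
  have b5 := hbd (a * b * e) (J - 1) (mul_ne_zero (mul_ne_zero ha hb) he)
  have b6 : |J - 1| ≤ |J| + 1 := by simpa using abs_sub J 1
  simp only [map_mul, abs_neg, abs_one] at b1 b2 b3 b4 b5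
  have hq : (1000 : ℤ) ≤ Fintype.card F := mod_cast hcard
  generalize (Fintype.card F : ℤ) = q at *
  rw [← sq_abs] at hJ
  have hlow : q - 76 ≤ 4 * |J| := by linarith
  have hlow2 : (q - 76) ^ 2 ≤ 16 * |J| ^ 2 := by nlinarith
  have hlow3 : (q - 1) * (q - 76) ^ 2 ≤ 96 * q ^ 2 := by nlinarith
  nlinarith [mul_nonneg (sub_nonneg.2 hq) (sq_nonneg q),
    mul_nonneg (sub_nonneg.2 hq) (sub_nonneg.2 hq)]

end QuadraticCharSums

theorem PadicInt.toZMod_ne_zero_iff_isUnit {p : ℕ} [Fact p.Prime] (x : ℤ_[p]) :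
    toZMod x ≠ 0 ↔ IsUnit x := by
  rw [ne_eq, ← RingHom.mem_ker, ker_toZMod, IsLocalRing.mem_maximalIdeal, mem_nonunits_iff, not_not]

/-- Hensel's lemma for square roots of units. -/
theorem PadicInt.exists_sq_eq_of_quadraticChar {p : ℕ} [Fact p.Prime] (hp : p ≠ 2) (x : ℤ_[p])
    (hx : quadraticChar (ZMod p) (toZMod x) = 1) : ∃ y : ℤ_[p], y ^ 2 = x := by
  have hx0 : toZMod x ≠ 0 := by
    intro h
    simp [h] at hx
  obtain ⟨r, hr⟩ := (quadraticChar_one_iff_isSquare hx0).1 hx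
  obtain ⟨y, rfl⟩ := ZMod.ringHom_surjective (toZMod (p := p)) r
  have hy : IsUnit y := by
    rw [← toZMod_ne_zero_iff_isUnit]
    intro h
    simp [h] at hr
    exact hx0 hr
  have h2 : IsUnit (2 : ℤ_[p]) := by
    rw [← toZMod_ne_zero_iff_isUnit, map_ofNat]
    exact Ring.two_ne_zero (by rwa [ZMod.ringChar_zmod_n])
  obtain ⟨z, hz, -⟩ := HenselianRing.is_henselian (I := IsLocalRing.maximalIdeal ℤ_[p])
    (Polynomial.X ^ 2 - Polynomial.C x) (Polynomial.monic_X_pow_sub_C x two_ne_zero) y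
    (by
      rw [← ker_toZMod, RingHom.mem_ker]
      simp [hr, sq])
    (by
      refine IsUnit.map _ ?_
      simpa [one_add_one_eq_two] using h2.mul hy)
  exact ⟨z, by simpa [sub_eq_zero] using hz⟩

theorem PadicInt.isUnit_intCast_of_not_dvd {p : ℕ} [Fact p.Prime] {n : ℤ} (h : ¬ (p : ℤ) ∣ n) :
    IsUnit (n : ℤ_[p]) := by
  rw [PadicInt.isUnit_iff]
  exact le_antisymm (PadicInt.norm_le_one _)
    (not_lt.1 fun h' => h ((PadicInt.norm_int_lt_one_iff_dvd n).1 h'))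

/-- For units `B`, `C`, `u` and a non-unit `A` of `ℤ_p`, with `p` large, the conic
`x² + C * y² = u` has a `p`-adic point at which `A + B * x⁶ + B * C³ * y⁶` is a square. -/
theorem PadicInt.exists_diagonal_point {p : ℕ} [Fact p.Prime] (hp : 1000 ≤ p)
    {A B C u : ℤ_[p]} (hA : ¬ IsUnit A) (hB : IsUnit B) (hC : IsUnit C) (hu : IsUnit u) :
    ∃ w x y : ℚ_[p], w ^ 2 = A + B * x ^ 6 + B * C ^ 3 * y ^ 6 ∧ x ^ 2 + C * y ^ 2 = u := by
  have hF : ringChar (ZMod p) ≠ 2 := by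
    rw [ZMod.ringChar_zmod_n]
    omega
  have h3 : (3 : ZMod p) ≠ 0 := by
    intro h
    have h' : ((3 : ℕ) : ZMod p) = 0 := mod_cast h
    rw [ZMod.natCast_eq_zero_iff] at h'
    have := Nat.le_of_dvd (by norm_num) h'
    omega
  rw [← toZMod_ne_zero_iff_isUnit] at hA hB hC hu
  rw [not_ne_iff] at hA
  obtain ⟨m, h1, h2, h3⟩ := exists_quadraticChar_eq hF h3 (by rwa [ZMod.card]) hu hC
    (mul_ne_zero hB hu)
  have hone : ∀ {t : ZMod p}, t ≠ 0 → quadraticChar (ZMod p) t * quadraticChar (ZMod p) t = 1 :=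
    fun ht => by rw [← sq, quadraticChar_sq_one ht]
  obtain ⟨M, rfl⟩ := ZMod.ringHom_surjective (toZMod (p := p)) m
  have hp2 : p ≠ 2 := by omega
  obtain ⟨r, hr⟩ := exists_sq_eq_of_quadraticChar hp2 (u * (M + 1)) (by
    rw [map_mul, map_add, map_one, map_mul, h1, hone hu])
  obtain ⟨s, hs⟩ := exists_sq_eq_of_quadraticChar hp2 (u * (M + 1) * (M * C)) (by
    simp only [map_mul, map_add, map_one, h1, h2, hone hu, hone hC, mul_one])
  obtain ⟨v, hv⟩ := exists_sq_eq_of_quadraticChar hp2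
    (A * (M + 1) ^ 2 + B * u ^ 3 * (M ^ 2 - M + 1)) (by
      simp only [map_add, map_mul, map_pow, map_sub, map_one, hA, zero_mul, zero_add] at h3 ⊢
      rw [h3]
      linear_combination (quadraticChar (ZMod p) (toZMod u)) ^ 4 * hone hB +
        ((quadraticChar (ZMod p) (toZMod u)) ^ 2 + 1) * hone hu)
  have hM0 : M + 1 ≠ 0 := by
    intro h
    have := congrArg toZMod h
    rw [map_add, map_one, map_zero] at this
    rw [this, MulChar.map_zero, eq_comm, quadraticChar_eq_zero_iff] at h1
    exact hu h1
  have hC0 : C ≠ 0 := by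
    rintro rfl
    simp at hC
  have hM0' : (M : ℚ_[p]) + 1 ≠ 0 := by
    simpa using PadicInt.coe_ne_zero.2 hM0
  have hC0' : (C : ℚ_[p]) ≠ 0 := PadicInt.coe_ne_zero.2 hC0
  have hr' : (r : ℚ_[p]) ^ 2 = u * (M + 1) := mod_cast congrArg (Subtype.val) hr
  have hs' : (s : ℚ_[p]) ^ 2 = u * (M + 1) * (M * C) := mod_cast congrArg (Subtype.val) hs
  have hv' : (v : ℚ_[p]) ^ 2 = A * (M + 1) ^ 2 + B * u ^ 3 * (M ^ 2 - M + 1) :=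
    mod_cast congrArg (Subtype.val) hv
  have hx : ((r : ℚ_[p]) / (M + 1)) ^ 2 = u / (M + 1) := by
    rw [div_pow, hr']
    field_simp
  have hy : ((s : ℚ_[p]) / ((M + 1) * C)) ^ 2 = u * M / ((M + 1) * C) := by
    rw [div_pow, hs']
    field_simp
  refine ⟨v / (M + 1), r / (M + 1), s / ((M + 1) * C), ?_, ?_⟩
  · rw [div_pow, hv', show 6 = 2 * 3 from rfl, pow_mul _ 2 3, pow_mul _ 2 3, hx, hy]
    field_simp
    ring
  · rw [hx, hy]
    field_simp
    ring

/-- There is a finite set `S` of primes such that: for all nonzero integers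
`A₁, A₂, A₃`, any nonzero rational `c` with `c³ = A₃/A₂`, and any prime `p ∉ S`
with `p ∣ A₁`, `v_p(A₁)` odd and `p ∤ A₂A₃`, for every `p`-adic unit `u` there are
`w, x₁, x₂, x₃ ∈ ℚ_p` with `x₁ ≠ 0`, `w² = A₁x₁⁶ + A₂x₂⁶ + A₃x₃⁶` and
`x₂² + c·x₃² = u·x₁²`. -/
theorem stmt_17 :
    ∃ S : Finset ℕ, (∀ p ∈ S, p.Prime) ∧
      ∀ (A₁ A₂ A₃ : ℤ), A₁ ≠ 0 → A₂ ≠ 0 → A₃ ≠ 0 →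
      ∀ c : ℚ, c ≠ 0 → c ^ 3 = (A₃ : ℚ) / (A₂ : ℚ) →
      ∀ p : ℕ, ∀ hp : p.Prime, p ∉ S →
        (p : ℤ) ∣ A₁ → Odd (padicValInt p A₁) → ¬ (p : ℤ) ∣ A₂ * A₃ →
        attainsAllUnits p hp A₁ A₂ A₃ c := by
  refine ⟨{p ∈ Finset.range 1000 | p.Prime}, fun p hp => (Finset.mem_filter.1 hp).2, ?_⟩
  intro A₁ A₂ A₃ _ hA₂ _ c _ hc p hp hpS hA _ hdvd
  have : Fact p.Prime := ⟨hp⟩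
  have hp_large : 1000 ≤ p := by
    simpa [hp] using hpS
  intro u hu
  have hU₂ : IsUnit (A₂ : ℤ_[p]) :=
    PadicInt.isUnit_intCast_of_not_dvd fun h => hdvd (h.mul_right _)
  have hU₃ : IsUnit (A₃ : ℤ_[p]) :=
    PadicInt.isUnit_intCast_of_not_dvd fun h => hdvd (h.mul_left _)
  have hU₁ : ¬ IsUnit (A₁ : ℤ_[p]) := by
    rw [PadicInt.isUnit_iff]
    exact ((PadicInt.norm_int_lt_one_iff_dvd A₁).2 hA).ne
  have hc' : (A₂ : ℚ_[p]) * (c : ℚ_[p]) ^ 3 = A₃ := by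
    have : (A₂ : ℚ) * c ^ 3 = A₃ := by
      rw [hc]
      field_simp
    exact_mod_cast congrArg (Rat.cast : ℚ → ℚ_[p]) this
  have hcnorm : ‖(c : ℚ_[p])‖ = 1 := by
    have h2 : ‖(A₂ : ℚ_[p])‖ = 1 := by simpa using PadicInt.isUnit_iff.1 hU₂
    have h3 : ‖(A₃ : ℚ_[p])‖ = 1 := by simpa using PadicInt.isUnit_iff.1 hU₃
    have := congrArg norm hc'
    rw [norm_mul, norm_pow, h2, h3, one_mul] at this
    exact (pow_eq_one_iff_of_nonneg (norm_nonneg _) three_ne_zero).1 this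
  obtain ⟨w, x, y, h, h'⟩ := PadicInt.exists_diagonal_point hp_large hU₁ hU₂
    (C := ⟨c, hcnorm.le⟩) (PadicInt.isUnit_iff.2 hcnorm) hu
  refine ⟨w, 1, x, y, one_ne_zero, ?_, by simpa using h'⟩
  rw [h, ← hc']
  simp
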